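/- arXiv:2007.14591 — 7 statements merged into one kernel-verified Lean document; each statement's English description precedes it below -/
import Mathlib

section
/- Let n and n_p be positive integers with n_p < n, let C be an n×n real symmetric positive definite matrix, let F be an n×n_p real matrix of rank n_p, and let β > β_ℓ > 0. If λ ∈ ℝ and v ∈ ℝⁿ with v ≠ 0 satisfy the generalized eigenvalue equation (C + β F Fᵀ) v = λ (C + β_ℓ F Fᵀ) v, then 1 ≤ λ ≤ (β μ₁ + 1)/(β_ℓ μ₁ + 1), where μ₁ is the largest eigenvalue of the symmetric positive definite matrix S_C = Fᵀ C⁻¹ F. -/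
open Matrix

/-- Eigenvalues of a real positive semidefinite matrix are nonnegative. -/
theorem Matrix.PosSemidef.nonneg_of_hasEigenvalue {m : Type*} [Fintype m]
    {S : Matrix m m ℝ} (hS : S.PosSemidef) {μ : ℝ}
    (hμ : Module.End.HasEigenvalue S.mulVecLin μ) : 0 ≤ μ := by
  obtain ⟨u, hu⟩ := hμ.exists_hasEigenvector
  have hSu : S *ᵥ u = μ • u := hu.apply_eq_smul
  have hnonneg : 0 ≤ u ⬝ᵥ (S *ᵥ u) := by simpa using hS.dotProduct_mulVec_nonneg u
  have hpos : 0 < u ⬝ᵥ u := by simpa using dotProduct_star_self_pos_iff.mpr hu.2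
  rw [hSu, dotProduct_smul, smul_eq_mul] at hnonneg
  exact nonneg_of_mul_nonneg_left hnonneg hpos

/-- Theorem 3.1: bound on the generalized eigenvalues of the pencil
`(C + β F Fᵀ, C + β_ℓ F Fᵀ)` in terms of the largest eigenvalue `μ₁` of
`S_C = Fᵀ C⁻¹ F`. -/
theorem generalized_eigenvalue_bound
    (n np : ℕ) (hn : 0 < n) (hnp0 : 0 < np) (hnp : np < n)
    (C : Matrix (Fin n) (Fin n) ℝ) (hC : C.PosDef)
    (F : Matrix (Fin n) (Fin np) ℝ) (hF : F.rank = np)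
    (β βl : ℝ) (hβl : 0 < βl) (hβ : βl < β)
    (μ₁ : ℝ)
    (hμ₁ : Module.End.HasEigenvalue (Matrix.mulVecLin (Fᵀ * C⁻¹ * F)) μ₁)
    (hμ₁max : ∀ μ : ℝ, Module.End.HasEigenvalue (Matrix.mulVecLin (Fᵀ * C⁻¹ * F)) μ → μ ≤ μ₁)
    (lam : ℝ) (v : Fin n → ℝ) (hv : v ≠ 0)
    (heig : (C + β • (F * Fᵀ)) *ᵥ v = lam • ((C + βl • (F * Fᵀ)) *ᵥ v)) :
    1 ≤ lam ∧ lam ≤ (β * μ₁ + 1) / (βl * μ₁ + 1) := by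
  have hS : (Fᵀ * C⁻¹ * F).PosSemidef := by
    simpa using hC.inv.posSemidef.conjTranspose_mul_mul_same F
  have hμ₁nonneg : 0 ≤ μ₁ := hS.nonneg_of_hasEigenvalue hμ₁
  have ha : 0 < v ⬝ᵥ (C *ᵥ v) := by simpa using hC.dotProduct_mulVec_pos hv
  have hb : 0 ≤ (Fᵀ *ᵥ v) ⬝ᵥ (Fᵀ *ᵥ v) := by
    simpa using dotProduct_star_self_nonneg (Fᵀ *ᵥ v)
  have hvec : (lam - 1) • (C *ᵥ v) = (β - lam * βl) • (F *ᵥ (Fᵀ *ᵥ v)) := by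
    simp only [add_mulVec, smul_mulVec, ← mulVec_mulVec] at heig
    ext i
    have := congrFun heig i
    simp only [Pi.add_apply, Pi.smul_apply, smul_eq_mul] at this ⊢
    linarith
  have hscalar : (lam - 1) * (v ⬝ᵥ (C *ᵥ v)) =
      (β - lam * βl) * ((Fᵀ *ᵥ v) ⬝ᵥ (Fᵀ *ᵥ v)) := by
    have := congrArg (v ⬝ᵥ ·) hvec
    simpa only [dotProduct_smul, smul_eq_mul, dotProduct_mulVec v F, ← mulVec_transpose] using this
  have hreduced : (lam - 1) • (Fᵀ *ᵥ v) =
      (β - lam * βl) • ((Fᵀ * C⁻¹ * F) *ᵥ (Fᵀ *ᵥ v)) := by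
    have hCdet : IsUnit C.det := C.isUnit_iff_isUnit_det.mp hC.isUnit
    have := congrArg ((Fᵀ * C⁻¹) *ᵥ ·) hvec
    simpa only [mulVec_smul, mulVec_mulVec, Matrix.mul_assoc, nonsing_inv_mul C hCdet,
      Matrix.mul_one] using this
  have hlam : 1 ≤ lam := by
    by_contra! h
    nlinarith [mul_pos (sub_pos.mpr h) ha, mul_nonneg (sub_pos.mpr h).le hb,
      mul_nonneg (mul_nonneg (sub_pos.mpr h).le hβl.le) hb,
      mul_nonneg (sub_pos.mpr hβ).le hb]
  refine ⟨hlam, ?_⟩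
  rw [le_div_iff₀ (by positivity)]
  rcases hlam.eq_or_lt with rfl | hlt
  · nlinarith
  have hprod : 0 < (β - lam * βl) * ((Fᵀ *ᵥ v) ⬝ᵥ (Fᵀ *ᵥ v)) :=
    hscalar ▸ mul_pos (sub_pos.mpr hlt) ha
  have hgap : 0 < β - lam * βl := pos_of_mul_pos_left hprod hb
  have hw : Fᵀ *ᵥ v ≠ 0 := by
    intro h
    simp [h] at hprod
  have hν := hμ₁max ((lam - 1) / (β - lam * βl)) <|
    Module.End.hasEigenvalue_of_hasEigenvector (x := Fᵀ *ᵥ v) <| by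
      refine ⟨Module.End.mem_eigenspace_iff.mpr ?_, hw⟩
      rw [mulVecLin_apply, div_eq_inv_mul, mul_smul, hreduced, inv_smul_smul₀ hgap.ne']
  rw [div_le_iff₀ hgap] at hν
  linarith
end

section
/- Let n_p < n, let C be an n×n real symmetric positive definite matrix, let F be an n×n_p real matrix, and let β_ℓ > 0. Then every eigenvalue λ ∈ ℝ of N = (C + β_ℓ F Fᵀ)⁻¹ C satisfies 0 < λ ≤ 1, and λ = 1 is attained as an eigenvalue of N; that is, the spectral radius of N equals 1. -/
open Matrix

/-- For positive definite `C` and positive semidefinite `P`, the eigenvectors of `(C + P)⁻¹ C`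
are those of the generalized eigenvalue problem `C v = μ (C + P) v`. -/
lemma hasEigenvector_inv_add_mul_iff {ι : Type*} [Fintype ι] [DecidableEq ι]
    {C P : Matrix ι ι ℝ} (hC : C.PosDef) (hP : P.PosSemidef) {μ : ℝ} {v : ι → ℝ} :
    Module.End.HasEigenvector (Matrix.mulVecLin ((C + P)⁻¹ * C)) μ v ↔
      C *ᵥ v = μ • ((C + P) *ᵥ v) ∧ v ≠ 0 := by
  have hu : IsUnit (C + P).det :=
    (Matrix.isUnit_iff_isUnit_det _).1 (hC.add_posSemidef hP).isUnit
  rw [Module.End.hasEigenvector_iff, Module.End.mem_eigenspace_iff, Matrix.mulVecLin_apply]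
  refine and_congr_left fun _ => ⟨fun h => ?_, fun h => ?_⟩
  · rw [← Matrix.mulVec_smul, ← h, Matrix.mulVec_mulVec, Matrix.mul_nonsing_inv_cancel_left _ _ hu]
  · rw [← Matrix.mulVec_mulVec, h, Matrix.mulVec_smul, Matrix.mulVec_mulVec,
      Matrix.nonsing_inv_mul _ hu, Matrix.one_mulVec]

lemma eigenvalue_inv_add_mul_mem_Ioc {ι : Type*} [Fintype ι] [DecidableEq ι]
    {C P : Matrix ι ι ℝ} (hC : C.PosDef) (hP : P.PosSemidef) {μ : ℝ}
    (hμ : Module.End.HasEigenvalue (Matrix.mulVecLin ((C + P)⁻¹ * C)) μ) :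
    μ ∈ Set.Ioc 0 1 := by
  obtain ⟨v, hv⟩ := hμ.exists_hasEigenvector
  obtain ⟨h, hv0⟩ := (hasEigenvector_inv_add_mul_iff hC hP).1 hv
  have hCv : 0 < v ⬝ᵥ C *ᵥ v := by simpa using hC.dotProduct_mulVec_pos hv0
  have hPv : 0 ≤ v ⬝ᵥ P *ᵥ v := by simpa using hP.dotProduct_mulVec_nonneg v
  have key : v ⬝ᵥ C *ᵥ v = μ * (v ⬝ᵥ C *ᵥ v + v ⬝ᵥ P *ᵥ v) := by
    rw [← dotProduct_add, ← Matrix.add_mulVec, ← smul_eq_mul, ← dotProduct_smul, ← h]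
  have hpos : 0 < μ := pos_of_mul_pos_left (key ▸ hCv) (by positivity)
  exact ⟨hpos, by nlinarith⟩

lemma exists_ne_zero_transpose_mulVec_eq_zero {K : Type*} [Field K] {n m : ℕ} (h : m < n)
    (F : Matrix (Fin n) (Fin m) K) : ∃ v ≠ 0, Fᵀ *ᵥ v = 0 := by
  have hker : LinearMap.ker Fᵀ.mulVecLin ≠ ⊥ :=
    LinearMap.ker_ne_bot_of_finrank_lt (by simpa using h)
  obtain ⟨v, hv, hv0⟩ := Submodule.exists_mem_ne_zero_of_ne_bot hker
  exact ⟨v, hv0, hv⟩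

/-- Every eigenvalue of `N = (C + β_ℓ F Fᵀ)⁻¹ C` lies in `(0, 1]`, and `1` is attained,
so the spectral radius of `N` equals `1`. -/
theorem spectral_radius_N
    (n np : ℕ) (hnp : np < n)
    (C : Matrix (Fin n) (Fin n) ℝ) (hC : C.PosDef)
    (F : Matrix (Fin n) (Fin np) ℝ)
    (βl : ℝ) (hβl : 0 < βl) :
    (∀ lam : ℝ, Module.End.HasEigenvalue (Matrix.mulVecLin ((C + βl • (F * Fᵀ))⁻¹ * C)) lam →
      0 < lam ∧ lam ≤ 1) ∧
    Module.End.HasEigenvalue (Matrix.mulVecLin ((C + βl • (F * Fᵀ))⁻¹ * C)) 1 := by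
  have hP : (βl • (F * Fᵀ)).PosSemidef := by
    simpa using (Matrix.posSemidef_self_mul_conjTranspose F).smul hβl.le
  refine ⟨fun _ h => eigenvalue_inv_add_mul_mem_Ioc hC hP h, ?_⟩
  obtain ⟨v, hv0, hv⟩ := exists_ne_zero_transpose_mulVec_eq_zero hnp F
  refine Module.End.hasEigenvalue_of_hasEigenvector (x := v)
    ((hasEigenvector_inv_add_mul_iff hC hP).2 ⟨?_, hv0⟩)
  rw [one_smul, Matrix.add_mulVec, Matrix.smul_mulVec, ← Matrix.mulVec_mulVec, hv,
    Matrix.mulVec_zero, smul_zero, add_zero]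
end

section
/- Let n_p < n, let C be an n×n real symmetric positive definite matrix, let F be an n×n_p real matrix of rank n_p, and let β > β_ℓ > 0. Set Ĉ = C + β F Fᵀ and Ĉ_ℓ = C + β_ℓ F Fᵀ. Then the iteration matrix G = I − (β_ℓ/β) Ĉ_ℓ⁻¹ Ĉ satisfies G = (1 − β_ℓ/β) Ĉ_ℓ⁻¹ C, every eigenvalue λ ∈ ℝ of G satisfies 0 < λ ≤ 1 − β_ℓ/β < 1, and 1 − β_ℓ/β is attained as an eigenvalue of G (i.e., the spectral radius of G is exactly 1 − β_ℓ/β). -/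
open Matrix

/-- The quadratic form of `F * Fᵀ` is `v ↦ ‖Fᵀ v‖²`. -/
theorem dotProduct_mul_transpose_mulVec {m k : Type*} [Fintype m] [Fintype k]
    (F : Matrix m k ℝ) (v : m → ℝ) :
    v ⬝ᵥ ((F * Fᵀ) *ᵥ v) = (Fᵀ *ᵥ v) ⬝ᵥ (Fᵀ *ᵥ v) := by
  rw [← mulVec_mulVec, dotProduct_mulVec, mulVec_transpose]

theorem Matrix.PosDef.dotProduct_mulVec_real_pos {m : Type*} [Fintype m] {C : Matrix m m ℝ}
    (hC : C.PosDef) {v : m → ℝ} (hv : v ≠ 0) : 0 < v ⬝ᵥ (C *ᵥ v) := by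
  simpa using hC.dotProduct_mulVec_pos hv

theorem Matrix.PosDef.add_smul_mul_transpose {m k : Type*} [Fintype m] [Fintype k]
    {C : Matrix m m ℝ} (hC : C.PosDef) (F : Matrix m k ℝ) {b : ℝ} (hb : 0 ≤ b) :
    (C + b • (F * Fᵀ)).PosDef := by
  have hF : (F * Fᵀ).PosSemidef := by
    simpa [conjTranspose_eq_transpose_of_trivial] using posSemidef_self_mul_conjTranspose F
  exact hC.add_posSemidef (hF.smul hb)

/-- Lemma 3.2: the iteration matrix `G = I − (β_ℓ/β) Ĉ_ℓ⁻¹ Ĉ` equals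
`(1 − β_ℓ/β) Ĉ_ℓ⁻¹ C`, its eigenvalues lie in `(0, 1 − β_ℓ/β]`, and `1 − β_ℓ/β < 1` is
attained, so the spectral radius of `G` is exactly `1 − β_ℓ/β`. -/
theorem iteration_matrix_spectral_radius
    (n np : ℕ) (hnp : np < n)
    (C : Matrix (Fin n) (Fin n) ℝ) (hC : C.PosDef)
    (F : Matrix (Fin n) (Fin np) ℝ) (hF : F.rank = np)
    (β βl : ℝ) (hβl : 0 < βl) (hβ : βl < β)
    (Chat Chatl G : Matrix (Fin n) (Fin n) ℝ)
    (hChat : Chat = C + β • (F * Fᵀ))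
    (hChatl : Chatl = C + βl • (F * Fᵀ))
    (hG : G = 1 - (βl / β) • (Chatl⁻¹ * Chat)) :
    G = (1 - βl / β) • (Chatl⁻¹ * C) ∧
    (∀ lam : ℝ, Module.End.HasEigenvalue (Matrix.mulVecLin G) lam →
      0 < lam ∧ lam ≤ 1 - βl / β) ∧
    1 - βl / β < 1 ∧
    Module.End.HasEigenvalue (Matrix.mulVecLin G) (1 - βl / β) := by
  have hβ0 : 0 < β := hβl.trans hβ
  have hr : βl / β < 1 := (div_lt_one hβ0).2 hβ
  have hr0 : 0 < βl / β := div_pos hβl hβ0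
  have hdet : IsUnit Chatl.det := by
    rw [hChatl]
    exact (hC.add_smul_mul_transpose F hβl.le).det_pos.ne'.isUnit
  have hsplit : (βl / β) • Chat = Chatl - (1 - βl / β) • C := by
    rw [hChat, hChatl, smul_add, smul_smul, div_mul_cancel₀ _ hβ0.ne']
    module
  have hGC : G = (1 - βl / β) • (Chatl⁻¹ * C) := by
    rw [hG, ← Matrix.mul_smul, hsplit, Matrix.mul_sub, nonsing_inv_mul _ hdet, Matrix.mul_smul,
      sub_sub_cancel]
  refine ⟨hGC, ?_, by linarith, ?_⟩
  · intro lam hlam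
    obtain ⟨v, hv⟩ := hlam.exists_hasEigenvector
    have hGv : G *ᵥ v = lam • v := hv.apply_eq_smul
    have hCv : (1 - βl / β) • (C *ᵥ v) = lam • (Chatl *ᵥ v) := by
      rw [← mulVec_smul Chatl, ← hGv, hGC, mulVec_mulVec, Matrix.mul_smul,
        mul_nonsing_inv_cancel_left _ _ hdet, smul_mulVec]
    have hpos := hC.dotProduct_mulVec_real_pos hv.2
    have hform := congrArg (v ⬝ᵥ ·) hCv
    simp only [hChatl, add_mulVec, smul_mulVec, dotProduct_add, dotProduct_smul, smul_eq_mul,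
      dotProduct_mul_transpose_mulVec] at hform
    have hq : 0 ≤ βl * ((Fᵀ *ᵥ v) ⬝ᵥ (Fᵀ *ᵥ v)) :=
      mul_nonneg hβl.le (Finset.sum_nonneg fun i _ => mul_self_nonneg _)
    generalize v ⬝ᵥ (C *ᵥ v) = c at hpos hform
    generalize βl * ((Fᵀ *ᵥ v) ⬝ᵥ (Fᵀ *ᵥ v)) = q at hq hform
    have hlam0 : 0 < lam := by
      refine pos_of_mul_pos_left (b := c + q) ?_ (by linarith)
      rw [← hform]
      exact mul_pos (by linarith) hpos
    refine ⟨hlam0, le_of_mul_le_mul_right ?_ hpos⟩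
    nlinarith [mul_nonneg hlam0.le hq]
  · obtain ⟨v, hv, hv0⟩ := Submodule.exists_mem_ne_zero_of_ne_bot
      (LinearMap.ker_ne_bot_of_finrank_lt (f := Fᵀ.mulVecLin) (by simpa using hnp))
    have hFv : Fᵀ *ᵥ v = 0 := hv
    have hCv : C *ᵥ v = Chatl *ᵥ v := by
      rw [hChatl, add_mulVec, smul_mulVec, ← mulVec_mulVec, hFv]
      simp
    refine Module.End.hasEigenvalue_of_hasEigenvector (x := v)
      ⟨Module.End.mem_eigenspace_iff.2 ?_, hv0⟩
    rw [mulVecLin_apply, hGC, smul_mulVec, ← mulVec_mulVec, hCv, mulVec_mulVec,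
      nonsing_inv_mul _ hdet, one_mulVec]
end

section
/- Let C be an n×n real symmetric positive definite matrix, F an n×n_p real matrix, and β > β_ℓ > 0. Set Ĉ = C + β F Fᵀ and Ĉ_ℓ = C + β_ℓ F Fᵀ. For any b ∈ ℝⁿ and any initial vector w₀ ∈ ℝⁿ, the sequence defined by w_{k+1} = w_k + (β_ℓ/β) Ĉ_ℓ⁻¹ (b − Ĉ w_k) converges (as k → ∞) to the unique solution w = Ĉ⁻¹ b of the system Ĉ w = b. -/
open Matrix

open scoped MatrixOrder in
/-- If the energies `e k ⬝ᵥ C *ᵥ e k` of a positive definite matrix `C` tend to zero,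
so do the vectors `e k`. -/
lemma Matrix.PosDef.tendsto_zero_of_energy {ι : Type*} [Fintype ι] [DecidableEq ι]
    {C : Matrix ι ι ℝ} (hC : C.PosDef) {e : ℕ → ι → ℝ}
    (he : Filter.Tendsto (fun k => e k ⬝ᵥ (C *ᵥ e k)) Filter.atTop (nhds 0)) :
    Filter.Tendsto e Filter.atTop (nhds 0) := by
  obtain ⟨B, hB, rfl⟩ :=
    CStarAlgebra.isStrictlyPositive_iff_eq_star_mul_self.mp hC.isStrictlyPositive
  rw [star_eq_conjTranspose] at he
  have henergy (x : ι → ℝ) : x ⬝ᵥ ((Bᴴ * B) *ᵥ x) = (B *ᵥ x) ⬝ᵥ (B *ᵥ x) := by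
    rw [← mulVec_mulVec, dotProduct_mulVec, conjTranspose_eq_transpose_of_trivial,
      vecMul_transpose]
  have hBe : Filter.Tendsto (fun k => B *ᵥ e k) Filter.atTop (nhds 0) := by
    rw [tendsto_pi_nhds]
    intro i
    have hsq : Filter.Tendsto (fun k => (B *ᵥ e k) i ^ 2) Filter.atTop (nhds 0) := by
      refine squeeze_zero (fun k => sq_nonneg _) (fun k => ?_) he
      rw [henergy, dotProduct, sq]
      exact Finset.single_le_sum (f := fun j => (B *ᵥ e k) j * (B *ᵥ e k) j)
        (fun j _ => mul_self_nonneg _) (Finset.mem_univ i)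
    rw [Pi.zero_apply, tendsto_zero_iff_abs_tendsto_zero]
    simpa [Function.comp_def, Real.sqrt_sq_eq_abs] using hsq.sqrt
  have hinv (x : ι → ℝ) : B⁻¹ *ᵥ (B *ᵥ x) = x := by
    rw [mulVec_mulVec, nonsing_inv_mul _ ((isUnit_iff_isUnit_det B).mp hB), one_mulVec]
  have hcont : Continuous fun x : ι → ℝ => B⁻¹ *ᵥ x := by fun_prop
  simpa [Function.comp_def, hinv] using (hcont.tendsto 0).comp hBe

/-- If `(C + P) y = q C x` with `P` positive semidefinite, then passing from `x` to `y`
multiplies the `C`-energy by at most `q ^ 2`. -/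
lemma Matrix.PosDef.energy_le_of_add_mulVec_eq {ι : Type*} [Fintype ι]
    {C P : Matrix ι ι ℝ} (hC : C.PosDef) (hP : P.PosSemidef) {q : ℝ} {x y : ι → ℝ}
    (hxy : (C + P) *ᵥ y = q • (C *ᵥ x)) :
    y ⬝ᵥ (C *ᵥ y) ≤ q ^ 2 * (x ⬝ᵥ (C *ᵥ x)) := by
  have hsymm : x ⬝ᵥ (C *ᵥ y) = y ⬝ᵥ (C *ᵥ x) := by
    have hCt : Cᵀ = C := by
      rw [← conjTranspose_eq_transpose_of_trivial]
      exact hC.isHermitian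
    rw [dotProduct_mulVec, ← mulVec_transpose, hCt, dotProduct_comm]
  have hpair := congrArg (y ⬝ᵥ ·) hxy
  have hPy := hP.dotProduct_mulVec_nonneg y
  have hdiff := hC.posSemidef.dotProduct_mulVec_nonneg (y - q • x)
  simp only [star_trivial, add_mulVec, mulVec_sub, mulVec_smul, dotProduct_add, sub_dotProduct,
    dotProduct_sub, smul_dotProduct, dotProduct_smul, smul_eq_mul, hsymm] at hpair hPy hdiff
  linarith


/-- Convergence of the stationary scheme (Method 1): the iterates
`w_{k+1} = w_k + (β_ℓ/β) Ĉ_ℓ⁻¹ (b − Ĉ w_k)` converge to the unique solution `Ĉ⁻¹ b` of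
`Ĉ w = b`. -/
theorem stationary_scheme_convergence
    (n np : ℕ)
    (C : Matrix (Fin n) (Fin n) ℝ) (hC : C.PosDef)
    (F : Matrix (Fin n) (Fin np) ℝ)
    (β βl : ℝ) (hβl : 0 < βl) (hβ : βl < β)
    (Chat Chatl : Matrix (Fin n) (Fin n) ℝ)
    (hChat : Chat = C + β • (F * Fᵀ))
    (hChatl : Chatl = C + βl • (F * Fᵀ))
    (b w₀ : Fin n → ℝ) (w : ℕ → Fin n → ℝ)
    (hw0 : w 0 = w₀)
    (hrec : ∀ k : ℕ, w (k + 1) = w k + (βl / β) • (Chatl⁻¹ *ᵥ (b - Chat *ᵥ w k))) :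
    (∀ x : Fin n → ℝ, Chat *ᵥ x = b ↔ x = Chat⁻¹ *ᵥ b) ∧
    Filter.Tendsto w Filter.atTop (nhds (Chat⁻¹ *ᵥ b)) := by
  have hFF : (F * Fᵀ).PosSemidef := by
    simpa using posSemidef_self_mul_conjTranspose F
  have hβpos : 0 < β := hβl.trans hβ
  have hdet {t : ℝ} (ht : 0 < t) : IsUnit (C + t • (F * Fᵀ)).det :=
    (isUnit_iff_isUnit_det _).mp (hC.add_posSemidef (hFF.smul ht.le)).isUnit
  have hChatdet : IsUnit Chat.det := hChat ▸ hdet hβpos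
  have hChatldet : IsUnit Chatl.det := hChatl ▸ hdet hβl
  have hsol : Chat *ᵥ (Chat⁻¹ *ᵥ b) = b := by
    rw [mulVec_mulVec, mul_nonsing_inv _ hChatdet, one_mulVec]
  refine ⟨fun x => ⟨?_, fun h => h ▸ hsol⟩, ?_⟩
  · rintro rfl
    rw [mulVec_mulVec, nonsing_inv_mul _ hChatdet, one_mulVec]
  set s := Chat⁻¹ *ᵥ b
  set q := 1 - βl / β with hq
  have hsplit : Chatl - (βl / β) • Chat = q • C := by
    rw [hChat, hChatl, smul_add, smul_smul, div_mul_cancel₀ _ hβpos.ne', hq, sub_smul, one_smul]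
    abel
  have hstep (k : ℕ) : (C + βl • (F * Fᵀ)) *ᵥ (w (k + 1) - s) = q • (C *ᵥ (w k - s)) := by
    have hcancel : Chatl *ᵥ (Chatl⁻¹ *ᵥ (b - Chat *ᵥ w k)) = b - Chat *ᵥ w k := by
      rw [mulVec_mulVec, mul_nonsing_inv _ hChatldet, one_mulVec]
    rw [← hChatl, ← smul_mulVec, ← hsplit, hrec, mulVec_sub, mulVec_add, mulVec_smul, hcancel,
      sub_mulVec, smul_mulVec, mulVec_sub, mulVec_sub, hsol, smul_sub, smul_sub]
    abel
  have hq0 : 0 ≤ q := by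
    rw [hq, sub_nonneg, div_le_one hβpos]
    exact hβ.le
  have hq1 : q < 1 := by
    rw [hq]
    linarith [div_pos hβl hβpos]
  have hbound (k : ℕ) : (w k - s) ⬝ᵥ (C *ᵥ (w k - s)) ≤
      (q ^ 2) ^ k * ((w 0 - s) ⬝ᵥ (C *ᵥ (w 0 - s))) := by
    induction k with
    | zero => simp
    | succ k ih =>
      calc _ ≤ q ^ 2 * ((w k - s) ⬝ᵥ (C *ᵥ (w k - s))) :=
            hC.energy_le_of_add_mulVec_eq (hFF.smul hβl.le) (hstep k)
        _ ≤ q ^ 2 * ((q ^ 2) ^ k * ((w 0 - s) ⬝ᵥ (C *ᵥ (w 0 - s)))) := by gcongr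
        _ = _ := by ring
  have hgeom := (tendsto_pow_atTop_nhds_zero_of_lt_one (sq_nonneg q)
    (pow_lt_one₀ hq0 hq1 two_ne_zero)).mul_const ((w 0 - s) ⬝ᵥ (C *ᵥ (w 0 - s)))
  rw [zero_mul] at hgeom
  rw [← tendsto_sub_nhds_zero_iff]
  exact hC.tendsto_zero_of_energy <| squeeze_zero
    (fun k => by simpa using hC.posSemidef.dotProduct_mulVec_nonneg (w k - s)) hbound hgeom
end

section
/- Let C be an n×n real symmetric positive definite matrix, F an n×n_p real matrix of rank n_p, and β ≥ 0. Set Z = C⁻¹ F, Ĉ = C + β F Fᵀ, S_C = Fᵀ C⁻¹ F, and E = Zᵀ Ĉ Z. Then the matrices S_C and I + β S_C are invertible and Z E⁻¹ Zᵀ = C⁻¹ F S_C⁻¹ (I + β S_C)⁻¹ Fᵀ C⁻¹. -/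
open Matrix

/-- A matrix of full column rank acts injectively on vectors. -/
theorem Matrix.mulVec_injective_of_rank_eq_card {m n K : Type*} [Fintype m] [Fintype n] [Field K]
    {A : Matrix m n K} (hA : A.rank = Fintype.card n) : Function.Injective A.mulVec := by
  have h := A.mulVecLin.finrank_range_add_finrank_ker
  rw [Module.finrank_fintype_fun_eq_card, ← hA] at h
  have hker : Module.finrank K (LinearMap.ker A.mulVecLin) = 0 := Nat.add_eq_left.mp h
  exact LinearMap.ker_eq_bot.mp (Submodule.finrank_eq_zero.mp hker)

/-- Equation (ZEZ): `S_C` and `I + β S_C` are invertible and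
`Z E⁻¹ Zᵀ = C⁻¹ F S_C⁻¹ (I + β S_C)⁻¹ Fᵀ C⁻¹`. -/
theorem ZEZ_identity
    (n np : ℕ)
    (C : Matrix (Fin n) (Fin n) ℝ) (hC : C.PosDef)
    (F : Matrix (Fin n) (Fin np) ℝ) (hF : F.rank = np)
    (β : ℝ) (hβ : 0 ≤ β)
    (Z : Matrix (Fin n) (Fin np) ℝ) (hZ : Z = C⁻¹ * F)
    (Chat : Matrix (Fin n) (Fin n) ℝ) (hChat : Chat = C + β • (F * Fᵀ))
    (SC : Matrix (Fin np) (Fin np) ℝ) (hSC : SC = Fᵀ * C⁻¹ * F)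
    (E : Matrix (Fin np) (Fin np) ℝ) (hE : E = Zᵀ * Chat * Z) :
    IsUnit SC ∧ IsUnit ((1 : Matrix (Fin np) (Fin np) ℝ) + β • SC) ∧
    Z * E⁻¹ * Zᵀ =
      C⁻¹ * F * SC⁻¹ * ((1 : Matrix (Fin np) (Fin np) ℝ) + β • SC)⁻¹ * Fᵀ * C⁻¹ := by
  have hCdet : IsUnit C.det := (isUnit_iff_isUnit_det C).mp hC.isUnit
  have hCinvT : (C⁻¹)ᵀ = C⁻¹ := by simpa using hC.inv.isHermitian.eq
  have hFinj : Function.Injective F.mulVec := mulVec_injective_of_rank_eq_card (by simpa using hF)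
  have hSCpos : SC.PosDef := by
    simpa [hSC] using hC.inv.conjTranspose_mul_mul_same hFinj
  have hSum : ((1 : Matrix (Fin np) (Fin np) ℝ) + β • SC).PosDef :=
    PosDef.one.add_posSemidef (hSCpos.posSemidef.smul hβ)
  have hZT : Zᵀ = Fᵀ * C⁻¹ := by rw [hZ, transpose_mul, hCinvT]
  have hEfac : E = (1 + β • SC) * SC := by
    have hCZ : C * Z = F := by rw [hZ, mul_nonsing_inv_cancel_left _ _ hCdet]
    have hFZ : Fᵀ * Z = SC := by rw [hZ, hSC, Matrix.mul_assoc]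
    have hZF : Zᵀ * F = SC := by rw [hZT, hSC]
    rw [hE, hChat, Matrix.mul_assoc, Matrix.add_mul, hCZ, Matrix.smul_mul, Matrix.mul_assoc, hFZ,
      Matrix.mul_add, Matrix.mul_smul, ← Matrix.mul_assoc, hZF, Matrix.add_mul, Matrix.one_mul,
      Matrix.smul_mul]
  refine ⟨hSCpos.isUnit, hSum.isUnit, ?_⟩
  rw [hEfac, Matrix.mul_inv_rev, hZT, hZ]
  simp only [Matrix.mul_assoc]
end

section
/- Let A be an invertible n_q×n_q real matrix, B an n_q×n_p real matrix, and α, γ real numbers with α ≠ 0. Set S̃_A = I_p + (γ/α) Bᵀ A⁻¹ B. Then the 3×3 block matrix identity [[I_u, 0, 0], [0, A, −B], [0, γ Bᵀ, α I_p]] = [[I_u, 0, 0], [0, A, 0], [0, γ Bᵀ, S̃_A]] · [[I_u, 0, 0], [0, I_q, −A⁻¹ B], [0, 0, α I_p]] holds, where I_u, I_q, I_p denote identity matrices of sizes n_u, n_q, n_p. -/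
open Matrix

/-- Block factorization (RPF_fact) of the factor `M₂` of the RPF preconditioner:
`[[I_u, 0, 0], [0, A, −B], [0, γ Bᵀ, α I_p]]`
`= [[I_u, 0, 0], [0, A, 0], [0, γ Bᵀ, S̃_A]] ⬝ [[I_u, 0, 0], [0, I_q, −A⁻¹B], [0, 0, α I_p]]`. -/
theorem M2_block_factorization
    (nu nq np : ℕ)
    (A : Matrix (Fin nq) (Fin nq) ℝ) (hA : IsUnit A)
    (B : Matrix (Fin nq) (Fin np) ℝ)
    (α γ : ℝ) (hα : α ≠ 0)
    (St : Matrix (Fin np) (Fin np) ℝ)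
    (hSt : St = 1 + (γ / α) • (Bᵀ * A⁻¹ * B)) :
    (fromBlocks (1 : Matrix (Fin nu) (Fin nu) ℝ) 0 0
        (fromBlocks A (-B) (γ • Bᵀ) (α • (1 : Matrix (Fin np) (Fin np) ℝ)))) =
      (fromBlocks (1 : Matrix (Fin nu) (Fin nu) ℝ) 0 0
          (fromBlocks A 0 (γ • Bᵀ) St)) *
        (fromBlocks (1 : Matrix (Fin nu) (Fin nu) ℝ) 0 0
          (fromBlocks (1 : Matrix (Fin nq) (Fin nq) ℝ) (-(A⁻¹ * B)) 0
            (α • (1 : Matrix (Fin np) (Fin np) ℝ)))) := by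
  have hdet : IsUnit A.det := (isUnit_iff_isUnit_det A).mp hA
  have upper_right : A * (A⁻¹ * B) = B := mul_nonsing_inv_cancel_left A B hdet
  have lower_right : -(γ • (Bᵀ * (A⁻¹ * B))) + α • St = α • 1 := by
    rw [hSt, smul_add, smul_smul, mul_div_cancel₀ _ hα, Matrix.mul_assoc]
    abel
  simp [fromBlocks_multiply, upper_right, lower_right]
end

section
/- Let A be an n_q×n_q real symmetric positive definite matrix, B an n_q×n_p real matrix, and α > 0, γ > 0 real numbers; set β = γ/α, Â = A + β B Bᵀ, S_A = Bᵀ A⁻¹ B, and S̃_A = I_p + β S_A (Â and S̃_A are invertible). For any vectors r_q ∈ ℝ^{n_q} and y_p ∈ ℝ^{n_p}, define t_q = Â⁻¹ (r_q + α⁻¹ B y_p) and t_p = α⁻¹ (y_p − γ Bᵀ t_q). Then t_p = S̃_A⁻¹ (α⁻¹ y_p − β Bᵀ A⁻¹ r_q) and t_q = A⁻¹ (r_q + B t_p). -/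
open Matrix

/-- Equivalence of Method 2 applied to the inner solve with `Â = A + β B Bᵀ` and the exact
block factorization of `M₂`: if `t_q = Â⁻¹ (r_q + α⁻¹ B y_p)` and
`t_p = α⁻¹ (y_p − γ Bᵀ t_q)`, then `t_p = S̃_A⁻¹ (α⁻¹ y_p − β Bᵀ A⁻¹ r_q)` and
`t_q = A⁻¹ (r_q + B t_p)`. -/
theorem method2_equivalence
    (nq np : ℕ)
    (A : Matrix (Fin nq) (Fin nq) ℝ) (hA : A.PosDef)
    (B : Matrix (Fin nq) (Fin np) ℝ)
    (α γ β : ℝ) (hα : 0 < α) (hγ : 0 < γ) (hβ : β = γ / α)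
    (Ahat : Matrix (Fin nq) (Fin nq) ℝ) (hAhat : Ahat = A + β • (B * Bᵀ))
    (SA : Matrix (Fin np) (Fin np) ℝ) (hSA : SA = Bᵀ * A⁻¹ * B)
    (St : Matrix (Fin np) (Fin np) ℝ) (hSt : St = 1 + β • SA)
    (rq : Fin nq → ℝ) (yp : Fin np → ℝ)
    (tq : Fin nq → ℝ) (tp : Fin np → ℝ)
    (htq : tq = Ahat⁻¹ *ᵥ (rq + α⁻¹ • (B *ᵥ yp)))
    (htp : tp = α⁻¹ • (yp - γ • (Bᵀ *ᵥ tq))) :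
    IsUnit Ahat ∧ IsUnit St ∧
    tp = St⁻¹ *ᵥ (α⁻¹ • yp - β • (Bᵀ *ᵥ (A⁻¹ *ᵥ rq))) ∧
    tq = A⁻¹ *ᵥ (rq + B *ᵥ tp) := by
  have hβ0 : 0 ≤ β := by rw [hβ]; positivity
  have hAhat_unit : IsUnit Ahat := by
    have hB : (B * Bᵀ).PosSemidef := by
      simpa only [conjTranspose_eq_transpose_of_trivial] using
        posSemidef_self_mul_conjTranspose B
    rw [hAhat]
    exact (hA.add_posSemidef (hB.smul hβ0)).isUnit
  have hSt_unit : IsUnit St := by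
    have hS : (Bᵀ * A⁻¹ * B).PosSemidef := by
      simpa only [conjTranspose_eq_transpose_of_trivial] using
        hA.inv.posSemidef.conjTranspose_mul_mul_same B
    rw [hSt, hSA]
    exact (PosDef.one.add_posSemidef (hS.smul hβ0)).isUnit
  have hA_det : IsUnit A.det := (isUnit_iff_isUnit_det A).mp hA.isUnit
  have hAhat_det : IsUnit Ahat.det := (isUnit_iff_isUnit_det Ahat).mp hAhat_unit
  have hSt_det : IsUnit St.det := (isUnit_iff_isUnit_det St).mp hSt_unit
  have htp_eq : tp = α⁻¹ • yp - β • (Bᵀ *ᵥ tq) := by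
    rw [htp, hβ, smul_sub, smul_smul, div_eq_inv_mul]
  have hAhat_tq : Ahat *ᵥ tq = rq + α⁻¹ • (B *ᵥ yp) := by
    rw [htq, mulVec_mulVec, mul_nonsing_inv _ hAhat_det, one_mulVec]
  have hA_tq : A *ᵥ tq = rq + B *ᵥ tp := by
    rw [hAhat, add_mulVec, smul_mulVec, ← mulVec_mulVec] at hAhat_tq
    rw [htp_eq, mulVec_sub, mulVec_smul, mulVec_smul, ← add_sub_assoc, ← hAhat_tq,
      add_sub_cancel_right]
  have htq_eq : tq = A⁻¹ *ᵥ (rq + B *ᵥ tp) := by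
    rw [← hA_tq, mulVec_mulVec, nonsing_inv_mul _ hA_det, one_mulVec]
  have hSt_tp : St *ᵥ tp = α⁻¹ • yp - β • (Bᵀ *ᵥ (A⁻¹ *ᵥ rq)) := by
    have hAB : A⁻¹ *ᵥ (B *ᵥ tp) = tq - A⁻¹ *ᵥ rq := by
      rw [eq_sub_iff_add_eq', ← mulVec_add, ← htq_eq]
    rw [hSt, hSA, add_mulVec, one_mulVec, smul_mulVec, ← mulVec_mulVec, ← mulVec_mulVec, hAB,
      mulVec_sub, smul_sub, htp_eq]
    abel
  refine ⟨hAhat_unit, hSt_unit, ?_, htq_eq⟩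
  rw [← hSt_tp, mulVec_mulVec, nonsing_inv_mul _ hSt_det, one_mulVec]
end
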